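/- Suppose each A_j is finite-dimensional over F, M ∈ ℤ, and the map f_j : A_{j+1} → A_j is injective for every j ≤ M. Then the quotient κ = L/K is isomorphic as an F-vector space to the eventual image ⋂_{i ≥ M+1} Im(F_{M+1,i}) ⊆ A_{M+1}. (This realizes the paper's description of its invariant κ as 'the largest subspace common to every A_j'.) -/

import Mathlib

/-- The inverse limit of a `ℤ`-indexed inverse system of `F`-vector spaces,
realised as the subspace of the product consisting of compatible sequences. -/
def invLim (F : Type*) [Field F] (A : ℤ → Type*) [∀ j, AddCommGroup (A j)]
    [∀ j, Module F (A j)] (f : ∀ j : ℤ, A (j + 1) →ₗ[F] A j) :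
    Submodule F (∀ j, A j) where
  carrier := {x | ∀ j, f j (x (j + 1)) = x j}
  add_mem' := by
    intro a b ha hb j
    simp only [Pi.add_apply, map_add, ha j, hb j]
  zero_mem' := by
    intro j
    simp
  smul_mem' := by
    intro c x hx j
    simp only [Pi.smul_apply, map_smul, hx j]

/-- The `j`-th coordinate projection out of the inverse limit. -/
def invLimProj (F : Type*) [Field F] (A : ℤ → Type*) [∀ j, AddCommGroup (A j)]
    [∀ j, Module F (A j)] (f : ∀ j : ℤ, A (j + 1) →ₗ[F] A j) (j : ℤ) :
    invLim F A f →ₗ[F] A j :=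
  (LinearMap.proj j).comp (invLim F A f).subtype

/-- The subspace of the inverse limit consisting of the sequences that vanish
for all sufficiently negative indices. -/
def vanishSub (F : Type*) [Field F] (A : ℤ → Type*) [∀ j, AddCommGroup (A j)]
    [∀ j, Module F (A j)] (f : ∀ j : ℤ, A (j + 1) →ₗ[F] A j) :
    Submodule F (invLim F A f) where
  carrier := {x | ∃ N : ℤ, ∀ j ≤ N, (x : ∀ k, A k) j = 0}
  add_mem' := by
    rintro a b ⟨N, hN⟩ ⟨M, hM⟩
    refine ⟨min N M, fun j hj => ?_⟩
    have h1 := hN j (hj.trans (min_le_left N M))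
    have h2 := hM j (hj.trans (min_le_right N M))
    show (a : ∀ k, A k) j + (b : ∀ k, A k) j = 0
    rw [h1, h2, add_zero]
  zero_mem' := ⟨0, fun j _ => rfl⟩
  smul_mem' := by
    rintro c a ⟨N, hN⟩
    refine ⟨N, fun j hj => ?_⟩
    show c • (a : ∀ k, A k) j = 0
    rw [hN j hj, smul_zero]

/-- Composites also factor on the left. -/
theorem Fc_left (F : Type*) [Field F] (A : ℤ → Type*) [∀ j, AddCommGroup (A j)]
    [∀ j, Module F (A j)]
    (f : ∀ j : ℤ, A (j + 1) →ₗ[F] A j)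
    (Fc : ∀ j i : ℤ, j ≤ i → (A i →ₗ[F] A j))
    (hFid : ∀ j : ℤ, Fc j j le_rfl = LinearMap.id)
    (hFsucc : ∀ (j i : ℤ) (h : j ≤ i) (h' : j ≤ i + 1),
      Fc j (i + 1) h' = (Fc j i h).comp (f i))
    (j i : ℤ) (h : j + 1 ≤ i) :
    Fc j i (by omega) = (f j).comp (Fc (j + 1) i h) := by
  induction i, h using Int.leInduction with
  | base => rw [hFsucc j j le_rfl, hFid, hFid]; rfl
  | succ n hn ih => rw [hFsucc j n (by omega), hFsucc (j + 1) n hn, ih]; rfl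

/-- The images in a fixed space decrease. -/
theorem Fc_range_anti (F : Type*) [Field F] (A : ℤ → Type*) [∀ j, AddCommGroup (A j)]
    [∀ j, Module F (A j)]
    (f : ∀ j : ℤ, A (j + 1) →ₗ[F] A j)
    (Fc : ∀ j i : ℤ, j ≤ i → (A i →ₗ[F] A j))
    (hFsucc : ∀ (j i : ℤ) (h : j ≤ i) (h' : j ≤ i + 1),
      Fc j (i + 1) h' = (Fc j i h).comp (f i))
    (j i k : ℤ) (h : j ≤ i) (hk : i ≤ k) :
    LinearMap.range (Fc j k (h.trans hk)) ≤ LinearMap.range (Fc j i h) := by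
  induction k, hk using Int.leInduction with
  | base => exact le_rfl
  | succ n hn ih =>
    rw [hFsucc j n (h.trans hn)]
    exact (LinearMap.range_comp_le_range _ _).trans ih

/-- Surjectivity between eventual images. -/
theorem Fc_surj (F : Type*) [Field F] (A : ℤ → Type*) [∀ j, AddCommGroup (A j)]
    [∀ j, Module F (A j)] [∀ j, FiniteDimensional F (A j)]
    (f : ∀ j : ℤ, A (j + 1) →ₗ[F] A j)
    (Fc : ∀ j i : ℤ, j ≤ i → (A i →ₗ[F] A j))
    (hFid : ∀ j : ℤ, Fc j j le_rfl = LinearMap.id)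
    (hFsucc : ∀ (j i : ℤ) (h : j ≤ i) (h' : j ≤ i + 1),
      Fc j (i + 1) h' = (Fc j i h).comp (f i))
    (j : ℤ) (y : A j) (hy : ∀ (i : ℤ) (h : j ≤ i), y ∈ LinearMap.range (Fc j i h)) :
    ∃ z : A (j + 1), f j z = y ∧
      ∀ (i : ℤ) (h : j + 1 ≤ i), z ∈ LinearMap.range (Fc (j + 1) i h) := by
  let a : ℕ →o (Submodule F (A (j + 1)))ᵒᵈ :=
    ⟨fun n => OrderDual.toDual (LinearMap.range (Fc (j + 1) (j + 1 + n) (by omega))),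
      fun m n hmn => Fc_range_anti F A f Fc hFsucc _ _ _ (by omega) (by omega)⟩
  obtain ⟨n, hn⟩ := IsArtinian.monotone_stabilizes a
  obtain ⟨w, hw⟩ := hy (j + 1 + n) (by omega)
  refine ⟨Fc (j + 1) (j + 1 + n) (by omega) w, ?_, ?_⟩
  · rw [← hw, Fc_left F A f Fc hFid hFsucc j _ (by omega)]; rfl
  · intro i hi
    have h1 : LinearMap.range (Fc (j + 1) (j + 1 + n) (by omega)) =
        LinearMap.range (Fc (j + 1) (j + 1 + (max n (i - (j + 1)).toNat : ℕ)) (by omega)) :=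
      hn _ (le_max_left _ _)
    apply Fc_range_anti F A f Fc hFsucc (j + 1) i
      (j + 1 + (max n (i - (j + 1)).toNat : ℕ)) hi (by omega)
    rw [← h1]
    exact ⟨w, rfl⟩

/-- If each `A j` is finite-dimensional and `f j` is injective for
every `j ≤ M`, then `κ = L/K` is isomorphic to the eventual image
`⋂_{i ≥ M+1} Im (F_{M+1,i}) ⊆ A (M+1)` — the largest subspace common to every
`A j`. -/
theorem statement8 (F : Type*) [Field F] (A : ℤ → Type*) [∀ j, AddCommGroup (A j)]
    [∀ j, Module F (A j)] [∀ j, FiniteDimensional F (A j)]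
    (f : ∀ j : ℤ, A (j + 1) →ₗ[F] A j)
    (Fc : ∀ j i : ℤ, j ≤ i → (A i →ₗ[F] A j))
    (hFid : ∀ j : ℤ, Fc j j le_rfl = LinearMap.id)
    (hFsucc : ∀ (j i : ℤ) (h : j ≤ i),
      Fc j (i + 1) (h.trans (by omega)) = (Fc j i h).comp (f i))
    (M : ℤ) (hinj : ∀ j ≤ M, Function.Injective (f j)) :
    Nonempty ((↥(invLim F A f) ⧸ vanishSub F A f) ≃ₗ[F]
      ↥(⨅ (i : ℤ) (h : M + 1 ≤ i), LinearMap.range (Fc (M + 1) i h))) := by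
  have hFs : ∀ (j i : ℤ) (h : j ≤ i) (h' : j ≤ i + 1),
      Fc j (i + 1) h' = (Fc j i h).comp (f i) := fun j i h _ => hFsucc j i h
  have hle : ∀ (x : invLim F A f) (j i : ℤ) (h : j ≤ i), Fc j i h (x.1 i) = x.1 j := by
    intro x j i h
    induction i, h using Int.leInduction with
    | base => rw [hFid]; rfl
    | succ n hn ih =>
      rw [hFsucc j n hn, LinearMap.comp_apply, x.2 n, ih]
  have hker : LinearMap.ker (invLimProj F A f (M + 1)) = vanishSub F A f := by
    ext x
    constructor
    · intro hx
      have hx' : x.1 (M + 1) = 0 := hx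
      refine ⟨M + 1, fun j hj => ?_⟩
      rw [← hle x j (M + 1) hj, hx', map_zero]
    · rintro ⟨N, hN⟩
      show x.1 (M + 1) = 0
      have key : ∀ (i : ℤ) (h : min N (M + 1) ≤ i), i ≤ M + 1 → x.1 i = 0 := by
        intro i h
        induction i, h using Int.leInduction with
        | base => intro _; exact hN _ (min_le_left _ _)
        | succ n hn ih =>
          intro h'
          apply hinj n (by omega)
          rw [x.2 n, map_zero]
          exact ih (by omega)
      exact key _ (min_le_right _ _) le_rfl
  have hrange : LinearMap.range (invLimProj F A f (M + 1)) =
      ⨅ (i : ℤ) (h : M + 1 ≤ i), LinearMap.range (Fc (M + 1) i h) := by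
    ext y
    simp only [Submodule.mem_iInf]
    constructor
    · rintro ⟨x, rfl⟩ i h
      exact ⟨x.1 i, hle x _ i h⟩
    · intro hy
      let P : ∀ j : ℤ, A j → Prop := fun j y =>
        ∀ (i : ℤ) (h : j ≤ i), y ∈ LinearMap.range (Fc j i h)
      let s : ∀ j : ℤ, M + 1 ≤ j → {y : A j // P j y} :=
        fun j h => Int.leInduction (motive := fun j _ => {y : A j // P j y}) ⟨y, hy⟩
          (fun k _ z => ⟨(Fc_surj F A f Fc hFid hFs k z.1 z.2).choose,
            (Fc_surj F A f Fc hFid hFs k z.1 z.2).choose_spec.2⟩) j h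
      have hs0 : (s (M + 1) le_rfl).1 = y := by
        simp only [s, Int.leInduction_base]
      have hs1 : ∀ (j : ℤ) (h : M + 1 ≤ j), f j (s (j + 1) (by omega)).1 = (s j h).1 := by
        intro j h
        simp only [s]
        rw [Int.leInduction_add_one _ _ j h]
        exact (Fc_surj F A f Fc hFid hFs j (s j h).1 (s j h).2).choose_spec.1
      let x : ∀ j, A j := fun j =>
        if h : M + 1 ≤ j then (s j h).1 else Fc j (M + 1) (by omega) y
      have hx : ∀ (j : ℤ) (h : j ≤ M + 1), x j = Fc j (M + 1) h y := by
        intro j h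
        rcases h.eq_or_lt with rfl | h'
        · simp only [x, le_refl, dite_true, hs0, hFid]; rfl
        · simp only [x, dif_neg (not_le.mpr h')]
      refine ⟨⟨x, fun j => ?_⟩, ?_⟩
      · by_cases h : M + 1 ≤ j
        · have h2 : M + 1 ≤ j + 1 := by omega
          simp only [x, dif_pos h, dif_pos h2]
          exact hs1 j h
        · rw [hx (j + 1) (by omega), hx j (by omega),
            Fc_left F A f Fc hFid hFs j (M + 1) (by omega)]
          rfl
      · show x (M + 1) = y
        rw [hx _ le_rfl, hFid]; rfl
  rw [← hrange, ← hker]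
  exact ⟨LinearMap.quotKerEquivRange _⟩
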